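/- arXiv:1611.01179 — 3 statements merged into one kernel-verified Lean document; each statement's English description precedes it below -/
import Mathlib

section
/- Let D ≥ 1, let R > 0, and let ρ be a Borel probability measure on ℝ^D with mean c = ∫ x dρ(x) that is supported in the closed ball of radius R centered at c. Let X₁,…,Xₙ be i.i.d. samples with law ρ and let ĉ = (1/n)·Σᵢ Xᵢ. Then for every t > 0, the probability that ‖ĉ − c‖ ≥ t is at most 8·exp(−3nt²/(6R² + 2Rt)). -/
open MeasureTheory

lemma cosh_convex_sq (p q A B u : ℝ) (hp : 0 ≤ p) (hq : 0 ≤ q) (hpq : p + q = 1)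
    (hu : u ^ 2 = p * A ^ 2 + q * B ^ 2) :
    Real.cosh u ≤ p * Real.cosh A + q * Real.cosh B := by
  have h1 := Real.hasSum_cosh u
  have h2 := ((Real.hasSum_cosh A).mul_left p).add ((Real.hasSum_cosh B).mul_left q)
  refine hasSum_le (fun k => ?_) h1 h2
  have hc := (convexOn_pow (𝕜 := ℝ) k).2 (x := A ^ 2) (y := B ^ 2) (sq_nonneg A) (sq_nonneg B)
    hp hq hpq
  simp only [smul_eq_mul] at hc
  rw [pow_mul, pow_mul, pow_mul, hu, ← mul_div_assoc, ← mul_div_assoc, ← add_div]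
  gcongr

lemma cosh_step {E : Type*} [NormedAddCommGroup E] [InnerProductSpace ℝ E] (x : E) :
    ∃ v : E, ∀ y : E, Real.cosh ‖x + y‖ ≤
      Real.cosh ‖x‖ * (Real.exp ‖y‖ - ‖y‖) + inner ℝ v y := by
  refine ⟨(Real.sinh ‖x‖ / ‖x‖) • x, fun y => ?_⟩
  rw [real_inner_smul_left]
  set a := ‖x‖ with ha
  set b := ‖y‖ with hb
  have ha0 : 0 ≤ a := norm_nonneg x
  have hb0 : 0 ≤ b := norm_nonneg y
  have hsb : b ≤ Real.sinh b := Real.self_le_sinh_iff.2 hb0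
  have hexp : Real.exp b = Real.cosh b + Real.sinh b := (Real.cosh_add_sinh b).symm
  have hca : Real.sinh a < Real.cosh a := Real.sinh_lt_cosh a
  have hsa : 0 ≤ Real.sinh a := Real.sinh_nonneg_iff.2 ha0
  rcases ha0.eq_or_lt with h0 | hapos
  · have hx : x = 0 := by rw [← norm_eq_zero, ← ha, ← h0]
    subst hx
    rw [zero_add, ← h0]
    simp only [inner_zero_left, Real.cosh_zero, mul_zero]
    linarith
  rcases hb0.eq_or_lt with h0 | hbpos
  · have hy : y = 0 := by rw [← norm_eq_zero, ← hb, ← h0]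
    subst hy
    rw [add_zero, ← h0]
    simp [← ha]
  obtain ⟨s, hs⟩ : ∃ s, s = inner ℝ x y / (a * b) := ⟨_, rfl⟩
  have hin : inner ℝ x y = a * b * s := by rw [hs]; field_simp
  have habs : |s| ≤ 1 := by rw [hs]; exact abs_real_inner_div_norm_mul_norm_le_one x y
  obtain ⟨hs1, hs2⟩ := abs_le.1 habs
  have hu : ‖x + y‖ ^ 2 = (1 + s) / 2 * (a + b) ^ 2 + (1 - s) / 2 * (a - b) ^ 2 := by
    rw [norm_add_sq_real, hin]; ring
  have h := cosh_convex_sq ((1 + s) / 2) ((1 - s) / 2) (a + b) (a - b) ‖x + y‖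
    (by linarith) (by linarith) (by ring) hu
  rw [Real.cosh_add, Real.cosh_sub] at h
  have e : Real.sinh a / a * (inner ℝ x y) = Real.sinh a * b * s := by
    rw [hin]; field_simp
  rw [e, hexp]
  have k1 : s * (Real.sinh a * (Real.sinh b - b)) ≤ 1 * (Real.cosh a * (Real.sinh b - b)) := by
    have := mul_nonneg hsa (sub_nonneg.2 hsb)
    have h3 : Real.sinh a * (Real.sinh b - b) ≤ Real.cosh a * (Real.sinh b - b) :=
      mul_le_mul_of_nonneg_right hca.le (sub_nonneg.2 hsb)
    nlinarith
  nlinarith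

lemma exp_bernstein (u : ℝ) (h0 : 0 ≤ u) (h3 : u < 3) :
    Real.exp u - 1 - u ≤ u ^ 2 / 2 / (1 - u / 3) := by
  have h1 := NormedSpace.expSeries_div_hasSum_exp (𝔸 := ℝ) u
  rw [← Real.exp_eq_exp_ℝ] at h1
  have h1 := (hasSum_nat_add_iff' 2).2 h1
  have h2 := (hasSum_geometric_of_lt_one (r := u / 3) (by positivity) (by linarith)).mul_left
    (u ^ 2 / 2)
  have h4 := hasSum_le (fun k => ?_) h1 h2
  · simp [Finset.sum_range_succ] at h4
    rw [div_eq_mul_inv _ (1 - u / 3)]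
    linarith
  · have hf : 2 * 3 ^ k ≤ (k + 2).factorial := by
      induction k with
      | zero => simp [Nat.factorial]
      | succ k ih =>
        rw [show k + 1 + 2 = (k + 2) + 1 by ring, Nat.factorial_succ, pow_succ]
        nlinarith [Nat.factorial_pos (k + 2)]
    have hf' : (2 * 3 ^ k : ℝ) ≤ ((k + 2).factorial : ℝ) := by exact_mod_cast hf
    rw [div_pow, div_mul_div_comm, ← pow_add, add_comm 2 k]
    gcongr

section
variable {E : Type*} [NormedAddCommGroup E] [InnerProductSpace ℝ E] [FiniteDimensional ℝ E]
  [MeasurableSpace E] [BorelSpace E]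

lemma lint_step (ρ : Measure E) [IsProbabilityMeasure ρ] (f : E → E) (hf : Measurable f) (b : ℝ)
    (hb : ∀ᵐ x ∂ρ, ‖f x‖ ≤ b) (hmean : ∫ x, f x ∂ρ = 0) (z : E) :
    ∫⁻ x, ENNReal.ofReal (Real.cosh ‖z + f x‖) ∂ρ
      ≤ ENNReal.ofReal (Real.exp b - b) * ENNReal.ofReal (Real.cosh ‖z‖) := by
  obtain ⟨v, hv⟩ := cosh_step z
  have hfi : Integrable f ρ := Integrable.of_bound hf.aestronglyMeasurable b hb
  have hii : Integrable (fun x => inner ℝ v (f x)) ρ := hfi.const_inner v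
  have hgi : Integrable (fun x => Real.cosh ‖z‖ * (Real.exp b - b) + inner ℝ v (f x)) ρ :=
    (integrable_const _).add hii
  have hle : ∀ᵐ x ∂ρ, Real.cosh ‖z + f x‖ ≤
      Real.cosh ‖z‖ * (Real.exp b - b) + inner ℝ v (f x) := by
    filter_upwards [hb] with x hx
    refine (hv (f x)).trans ?_
    have : Real.exp ‖f x‖ - ‖f x‖ ≤ Real.exp b - b := by
      have h1 := Real.add_one_le_exp (b - ‖f x‖)
      have h2 : Real.exp b = Real.exp ‖f x‖ * Real.exp (b - ‖f x‖) := by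
        rw [← Real.exp_add]; congr 1; ring
      have h3 := Real.one_le_exp (norm_nonneg (f x))
      rw [h2]
      nlinarith
    have := mul_le_mul_of_nonneg_left this (Real.cosh_pos ‖z‖).le
    linarith
  calc _ ≤ ∫⁻ x, ENNReal.ofReal (Real.cosh ‖z‖ * (Real.exp b - b) + inner ℝ v (f x)) ∂ρ :=
        lintegral_mono_ae (hle.mono fun x hx => ENNReal.ofReal_le_ofReal hx)
    _ = ENNReal.ofReal (∫ x, (Real.cosh ‖z‖ * (Real.exp b - b) + inner ℝ v (f x)) ∂ρ) :=
        (ofReal_integral_eq_lintegral_ofReal hgi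
          (hle.mono fun x hx => (Real.cosh_pos _).le.trans hx)).symm
    _ = _ := by
        rw [integral_add (integrable_const _) hii, integral_inner hfi, hmean]
        simp only [integral_const, inner_zero_right, probReal_univ, one_smul, add_zero]
        rw [mul_comm, ENNReal.ofReal_mul]
        have := Real.add_one_le_exp b
        linarith

lemma lint_pi (ρ : Measure E) [IsProbabilityMeasure ρ] (f : E → E) (hf : Measurable f) (b : ℝ)
    (hb : ∀ᵐ x ∂ρ, ‖f x‖ ≤ b) (hmean : ∫ x, f x ∂ρ = 0) (n : ℕ) (z : E) :
    ∫⁻ X, ENNReal.ofReal (Real.cosh ‖z + ∑ i, f (X i)‖) ∂(Measure.pi fun _ : Fin n => ρ)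
      ≤ ENNReal.ofReal (Real.exp b - b) ^ n * ENNReal.ofReal (Real.cosh ‖z‖) := by
  induction n generalizing z with
  | zero => simp
  | succ n ih =>
    have hmp := measurePreserving_piFinSuccAbove (fun _ : Fin (n + 1) => ρ) 0
    have hm : Measurable fun p : E × (Fin n → E) =>
        ENNReal.ofReal (Real.cosh ‖z + f p.1 + ∑ i, f (p.2 i)‖) := by
      refine ENNReal.measurable_ofReal.comp (Real.continuous_cosh.measurable.comp ?_)
      refine Measurable.norm ?_
      refine ((measurable_const.add (hf.comp measurable_fst))).add ?_
      exact Finset.measurable_fun_sum _ fun i _ =>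
        hf.comp ((measurable_pi_apply i).comp measurable_snd)
    have key := hmp.lintegral_comp hm
    calc _ = ∫⁻ X, ENNReal.ofReal (Real.cosh ‖z + f (X 0) + ∑ i : Fin n, f (X i.succ)‖)
            ∂(Measure.pi fun _ : Fin (n + 1) => ρ) := by
          simp only [Fin.sum_univ_succ, add_assoc]
      _ = _ := key
      _ = ∫⁻ x, ∫⁻ Y, ENNReal.ofReal (Real.cosh ‖z + f x + ∑ i, f (Y i)‖)
            ∂(Measure.pi fun _ : Fin n => ρ) ∂ρ := lintegral_prod _ hm.aemeasurable
      _ ≤ ∫⁻ x, ENNReal.ofReal (Real.exp b - b) ^ n *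
            ENNReal.ofReal (Real.cosh ‖z + f x‖) ∂ρ := lintegral_mono fun x => ih _
      _ = ENNReal.ofReal (Real.exp b - b) ^ n *
            ∫⁻ x, ENNReal.ofReal (Real.cosh ‖z + f x‖) ∂ρ :=
          lintegral_const_mul' _ _ (by finiteness)
      _ ≤ ENNReal.ofReal (Real.exp b - b) ^ n *
            (ENNReal.ofReal (Real.exp b - b) * ENNReal.ofReal (Real.cosh ‖z‖)) := by
          gcongr
          exact lint_step ρ f hf b hb hmean z
      _ = _ := by rw [pow_succ, mul_assoc]

end

/-- Bernstein inequality for the empirical mean.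
If ρ is a Borel probability measure on ℝ^D supported in the closed ball of radius R
around its mean c = ∫ x dρ(x), then the empirical mean ĉ = (1/n)·Σᵢ Xᵢ of n i.i.d.
samples concentrates around c. -/
theorem empirical_mean_bernstein
    (D n : ℕ) (hD : 1 ≤ D) (hn : 1 ≤ n) (R : ℝ) (hR : 0 < R)
    (ρ : Measure (EuclideanSpace ℝ (Fin D))) [IsProbabilityMeasure ρ]
    (hsupp : ρ (Metric.closedBall (∫ x, x ∂ρ) R)ᶜ = 0)
    (t : ℝ) (ht : 0 < t) :
    (Measure.pi fun _ : Fin n => ρ)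
      {X : Fin n → EuclideanSpace ℝ (Fin D) |
        t ≤ ‖(n : ℝ)⁻¹ • (∑ i, X i) - ∫ x, x ∂ρ‖}
      ≤ ENNReal.ofReal
          (8 * Real.exp (-(3 * n * t ^ 2) / (6 * R ^ 2 + 2 * R * t))) := by
  set c := ∫ x, x ∂ρ with hc
  have hnpos : (0 : ℝ) < n := by exact_mod_cast hn
  have hae : ∀ᵐ x ∂ρ, ‖x - c‖ ≤ R := by
    rw [ae_iff]
    convert hsupp using 2
    ext x
    simp [dist_eq_norm]
  have hid : Integrable (fun x : EuclideanSpace ℝ (Fin D) => x) ρ := by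
    have : Integrable (fun x : EuclideanSpace ℝ (Fin D) => x - c) ρ :=
      Integrable.of_bound (by fun_prop) R hae
    refine (this.add (integrable_const c)).congr (Filter.Eventually.of_forall fun x => ?_)
    exact sub_add_cancel x c
  obtain ⟨l, hl⟩ : ∃ l, l = t / (R ^ 2 + R * t / 3) := ⟨_, rfl⟩
  have hlpos : 0 < l := by rw [hl]; positivity
  have hmain := lint_pi ρ (fun x => l • (x - c)) (by fun_prop) (l * R)
    (by
      filter_upwards [hae] with x hx
      rw [norm_smul, Real.norm_of_nonneg hlpos.le]
      gcongr)
    (by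
      rw [integral_smul, integral_sub hid (integrable_const _)]
      simp [← hc]) n 0
  have hK1 := Real.add_one_le_exp (l * R)
  simp only [zero_add, norm_zero, Real.cosh_zero, ENNReal.ofReal_one, mul_one] at hmain
  have hmarkov := mul_meas_ge_le_lintegral₀
    (μ := Measure.pi fun _ : Fin n => ρ)
    (f := fun X => ENNReal.ofReal (Real.cosh ‖∑ i, l • (X i - c)‖))
    (by
      apply Measurable.aemeasurable
      refine ENNReal.measurable_ofReal.comp (Real.continuous_cosh.measurable.comp ?_)
      fun_prop) (ENNReal.ofReal (Real.exp (l * n * t) / 2))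
  have hpos : 0 < Real.exp (l * n * t) / 2 := by positivity
  have hsub : {X : Fin n → EuclideanSpace ℝ (Fin D) | t ≤ ‖(n : ℝ)⁻¹ • (∑ i, X i) - c‖} ⊆
      {X | ENNReal.ofReal (Real.exp (l * n * t) / 2) ≤
        ENNReal.ofReal (Real.cosh ‖∑ i, l • (X i - c)‖)} := by
    intro X hX
    simp only [Set.mem_ofPred_eq] at hX ⊢
    apply ENNReal.ofReal_le_ofReal
    have e : ∑ i, l • (X i - c) = (l * n) • ((n : ℝ)⁻¹ • (∑ i, X i) - c) := by
      rw [← Finset.smul_sum, Finset.sum_sub_distrib, mul_smul, smul_sub (n : ℝ), smul_smul,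
        mul_inv_cancel₀ hnpos.ne', one_smul]
      simp [Nat.cast_smul_eq_nsmul]
    rw [e, norm_smul, Real.norm_of_nonneg (by positivity), Real.cosh_eq]
    have : Real.exp (l * n * t) ≤ Real.exp (l * n * ‖(n : ℝ)⁻¹ • (∑ i, X i) - c‖) := by
      gcongr
    have := Real.exp_pos (-(l * n * ‖(n : ℝ)⁻¹ • (∑ i, X i) - c‖))
    linarith
  refine (measure_mono hsub).trans ?_
  have h5 := (hmarkov.trans hmain)
  rw [mul_comm, ← ENNReal.le_div_iff_mul_le (Or.inl (by simpa using hpos)) (Or.inl (by finiteness)),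
    ← ENNReal.ofReal_pow (by linarith), ← ENNReal.ofReal_div_of_pos hpos] at h5
  refine h5.trans (ENNReal.ofReal_le_ofReal ?_)
  have hu3 : l * R < 3 := by
    rw [hl, div_mul_eq_mul_div, div_lt_iff₀ (by positivity)]
    nlinarith [sq_nonneg R, pow_pos hR 2]
  have hb := exp_bernstein (l * R) (by positivity) hu3
  have hK : Real.exp (l * R) - l * R ≤
      Real.exp ((l * R) ^ 2 / 2 / (1 - l * R / 3)) := by
    have := Real.add_one_le_exp ((l * R) ^ 2 / 2 / (1 - l * R / 3))
    linarith
  have hK' : (Real.exp (l * R) - l * R) ^ n ≤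
      Real.exp (n * ((l * R) ^ 2 / 2 / (1 - l * R / 3))) := by
    rw [Real.exp_nat_mul]
    exact pow_le_pow_left₀ (by linarith) hK n
  have hs : (1 - l * R / 3) = R ^ 2 / (R ^ 2 + R * t / 3) := by
    rw [hl]; field_simp; ring
  have hexpo : n * ((l * R) ^ 2 / 2 / (1 - l * R / 3)) =
      l * n * t + -(3 * n * t ^ 2) / (6 * R ^ 2 + 2 * R * t) := by
    rw [hs, hl]; field_simp; ring
  rw [hexpo, Real.exp_add] at hK'
  rw [div_le_iff₀ hpos]
  refine hK'.trans ?_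
  have := Real.exp_pos (l * n * t)
  have := Real.exp_pos (-(3 * n * t ^ 2) / (6 * R ^ 2 + 2 * R * t))
  nlinarith [mul_pos (Real.exp_pos (l * n * t))
    (Real.exp_pos (-(3 * n * t ^ 2) / (6 * R ^ 2 + 2 * R * t)))]
end

section
/- Let D ≥ 1, r > 0, θ₂ > 0. Let ρ be a Borel probability measure on ℝ^D and let C ⊆ ℝ^D be a Borel set with ρ(C) > 0, with conditional mean c = ρ(C)⁻¹∫_C x dρ(x), such that for ρ-a.e. x ∈ C one has ‖x − c‖ ≤ θ₂·r. Let X₁,…,Xₙ be i.i.d. samples with law ρ, let n̂ = #{i : Xᵢ ∈ C}, and on the event {n̂ ≥ 1} let ĉ = n̂⁻¹·Σ_{Xᵢ∈C} Xᵢ. Then for every t > 0, the probability of the event { n̂ = 0, or (n̂ ≥ 1 and ‖ĉ − c‖ ≥ t) } is at most 2·exp(−3nρ(C)/28) + 8·exp(−3nρ(C)t²/(12θ₂²r² + 4θ₂rt)). -/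
open MeasureTheory

/-- The conditional mean c = ρ(C)⁻¹ ∫_C x dρ(x) of a measure ρ on a set C. -/
noncomputable def condMean (D : ℕ) (ρ : Measure (EuclideanSpace ℝ (Fin D)))
    (C : Set (EuclideanSpace ℝ (Fin D))) : EuclideanSpace ℝ (Fin D) :=
  ((ρ C).toReal)⁻¹ • ∫ x in C, x ∂ρ

/-- The number n̂ = #{i : Xᵢ ∈ C} of samples falling in C. -/
noncomputable def sampleCount {D n : ℕ} (C : Set (EuclideanSpace ℝ (Fin D)))
    (X : Fin n → EuclideanSpace ℝ (Fin D)) : ℕ :=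
  Nat.card {i : Fin n // X i ∈ C}

/-- The empirical conditional mean ĉ = n̂⁻¹ Σ_{Xᵢ∈C} Xᵢ (junk value when n̂ = 0). -/
noncomputable def condEmpMean (D n : ℕ) (C : Set (EuclideanSpace ℝ (Fin D)))
    (X : Fin n → EuclideanSpace ℝ (Fin D)) : EuclideanSpace ℝ (Fin D) :=
  ((sampleCount C X : ℝ))⁻¹ • ∑ i, Set.indicator C id (X i)


/-- Chord bound for the convex function `u ↦ cosh (√u)`. -/
lemma aux_cosh_chord (v A B z : ℝ) (hv : v ^ 2 ≤ A ^ 2 + B ^ 2 + 2 * A * B * z)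
    (h1 : -1 ≤ z) (h2 : z ≤ 1) :
    Real.cosh v ≤ Real.cosh A * Real.cosh B + z * (Real.sinh A * Real.sinh B) := by
  have e : Real.cosh A * Real.cosh B + z * (Real.sinh A * Real.sinh B)
      = (1 + z) / 2 * Real.cosh (A + B) + (1 - z) / 2 * Real.cosh (A - B) := by
    rw [Real.cosh_add, Real.cosh_sub]; ring
  rw [e]
  have s1 := (Real.hasSum_cosh (A + B)).mul_left ((1 + z) / 2)
  have s2 := (Real.hasSum_cosh (A - B)).mul_left ((1 - z) / 2)
  refine hasSum_le (fun k => ?_) (Real.hasSum_cosh v) (s1.add s2)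
  have hc := (And.right (convexOn_pow (𝕜 := ℝ) k)) (Set.mem_Ici.2 (sq_nonneg (A + B)))
    (Set.mem_Ici.2 (sq_nonneg (A - B)))
    (by linarith : 0 ≤ (1 + z) / 2) (by linarith : 0 ≤ (1 - z) / 2) (by ring)
  simp only [smul_eq_mul] at hc
  have hk : (v ^ 2) ^ k ≤ ((1 + z) / 2 * (A + B) ^ 2 + (1 - z) / 2 * (A - B) ^ 2) ^ k := by
    apply pow_le_pow_left₀ (sq_nonneg _)
    nlinarith
  have h := hk.trans hc
  simp only [← pow_mul] at h
  have hf : (0 : ℝ) < ((2 * k).factorial : ℝ) := by positivity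
  have h' := div_le_div_of_nonneg_right h hf.le
  calc _ ≤ _ := h'
    _ = _ := by ring

/-- Linear-plus-constant upper bound for `cosh` of the norm of a perturbed vector. -/
lemma aux_cosh_norm {E : Type*} [NormedAddCommGroup E] [InnerProductSpace ℝ E]
    (s : E) (l M : ℝ) (hM : 0 < M) :
    ∃ k : ℝ, ∀ y : E, ‖y‖ ≤ M →
      Real.cosh (l * ‖s + y‖) ≤ Real.cosh (l * ‖s‖) * Real.cosh (l * M) + k * inner ℝ s y := by
  refine ⟨Real.sinh (l * ‖s‖) * Real.sinh (l * M) / (‖s‖ * M), fun y hy => ?_⟩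
  have hin : |inner ℝ s y| ≤ ‖s‖ * M :=
    (abs_real_inner_le_norm s y).trans (mul_le_mul_of_nonneg_left hy (norm_nonneg _))
  have hz : |inner ℝ s y / (‖s‖ * M)| ≤ 1 := by
    rw [abs_div, abs_of_nonneg (by positivity : 0 ≤ ‖s‖ * M)]
    exact div_le_one_of_le₀ hin (by positivity)
  have hz' := abs_le.1 hz
  have hmul : ‖s‖ * M * (inner ℝ s y / (‖s‖ * M)) = inner ℝ s y := by
    rcases eq_or_ne s 0 with h | h
    · simp [h]
    · have : ‖s‖ ≠ 0 := norm_ne_zero_iff.2 h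
      field_simp
  have key := aux_cosh_chord (l * ‖s + y‖) (l * ‖s‖) (l * M) (inner ℝ s y / (‖s‖ * M)) (by
    have h1 := norm_add_sq_real s y
    have h2 : ‖y‖ ^ 2 ≤ M ^ 2 := pow_le_pow_left₀ (norm_nonneg _) hy 2
    have h3 : 2 * (l * ‖s‖) * (l * M) * (inner ℝ s y / (‖s‖ * M)) = 2 * l ^ 2 * inner ℝ s y := by
      rw [← hmul]; rw [hmul]; linear_combination 2 * l ^ 2 * hmul
    rw [h3, mul_pow, h1]
    nlinarith [mul_le_mul_of_nonneg_left h2 (sq_nonneg l)]) hz'.1 hz'.2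
  calc _ ≤ _ := key
    _ = _ := by ring

/-- Tensorization of a one-step bound over a product measure. -/
lemma aux_tensor {α E : Type*} [MeasurableSpace α] [AddCommMonoid E] [MeasurableSpace E]
    [MeasurableAdd₂ E] (ρ : Measure α) [SigmaFinite ρ] (g : E → ENNReal) (hg : Measurable g)
    (f : α → E) (hf : Measurable f) (w : α → ENNReal) (hw : Measurable w) (q : ENNReal)
    (h : ∀ s, ∫⁻ x, g (s + f x) * w x ∂ρ ≤ g s * q) (n : ℕ) :
    ∀ s, ∫⁻ X, g (s + ∑ i, f (X i)) * ∏ i, w (X i) ∂(Measure.pi fun _ : Fin n => ρ)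
      ≤ g s * q ^ n := by
  induction n with
  | zero => intro s; simp
  | succ n ih =>
    intro s
    have mp := (measurePreserving_piFinSuccAbove (fun _ : Fin (n + 1) => ρ) 0).symm
    rw [← mp.lintegral_comp_emb (MeasurableEquiv.measurableEmbedding _)]
    have hm : Measurable fun X : α × (Fin n → α) =>
        g ((s + f X.1) + ∑ i, f (X.2 i)) * (w X.1 * ∏ i, w (X.2 i)) := by
      fun_prop
    calc _ = ∫⁻ X, g ((s + f X.1) + ∑ i, f (X.2 i)) * (w X.1 * ∏ i, w (X.2 i))
            ∂(ρ.prod (Measure.pi fun _ : Fin n => ρ)) := by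
          refine lintegral_congr fun X => ?_
          simp [Fin.sum_univ_succ, Fin.prod_univ_succ, MeasurableEquiv.piFinSuccAbove, add_assoc]
      _ = ∫⁻ x, ∫⁻ Y, w x * (g ((s + f x) + ∑ i, f (Y i)) * ∏ i, w (Y i))
            ∂(Measure.pi fun _ : Fin n => ρ) ∂ρ := by
          rw [lintegral_prod _ hm.aemeasurable]
          refine lintegral_congr fun x => lintegral_congr fun Y => ?_
          ring
      _ ≤ ∫⁻ x, (g (s + f x) * w x) * q ^ n ∂ρ := by
          refine lintegral_mono fun x => ?_
          dsimp only
          rw [lintegral_const_mul _ (by fun_prop)]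
          calc _ ≤ w x * (g (s + f x) * q ^ n) := by gcongr; exact ih _
            _ = _ := by ring
      _ = (∫⁻ x, g (s + f x) * w x ∂ρ) * q ^ n := lintegral_mul_const _ (by fun_prop)
      _ ≤ g s * q * q ^ n := by gcongr; exact h s
      _ = _ := by ring

/-- The final numerical comparison. -/
lemma aux_numeric (n : ℕ) (p M t : ℝ) (hp : 0 ≤ p) (hp1 : p ≤ 1) (hM : 0 < M) (ht : 0 < t) :
    2 * (1 - p + p * Real.exp (-(t ^ 2 / (2 * M ^ 2)))) ^ n ≤
      2 * Real.exp (-(3 * n * p) / 28) +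
        8 * Real.exp (-(3 * n * p * t ^ 2) / (12 * M ^ 2 + 4 * M * t)) := by
  set a := t ^ 2 / (2 * M ^ 2) with ha
  have ha0 : 0 < a := by positivity
  have hnp : 0 ≤ n * p := by positivity
  have hea := Real.exp_pos (-a)
  have h1 : (1 - p + p * Real.exp (-a)) ^ n ≤ Real.exp (-(n * p * (1 - Real.exp (-a)))) := by
    calc _ ≤ (Real.exp (-(p * (1 - Real.exp (-a))))) ^ n := by
          apply pow_le_pow_left₀
          · have := mul_nonneg hp hea.le
            linarith
          · have := Real.add_one_le_exp (-(p * (1 - Real.exp (-a))))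
            linarith
      _ = _ := by rw [← Real.exp_nat_mul]; congr 1; ring
  have hexp : Real.exp (-a) ≤ 1 / (1 + a) := by
    rw [Real.exp_neg, ← one_div]
    apply one_div_le_one_div_of_le (by linarith)
    linarith [Real.add_one_le_exp a]
  have p1 := Real.exp_pos (-(3 * n * p) / 28)
  have p2 := Real.exp_pos (-(3 * n * p * t ^ 2) / (12 * M ^ 2 + 4 * M * t))
  rcases le_or_gt a 1 with h | h
  · have h2 : a / 2 ≤ 1 - Real.exp (-a) := by
      have : 1 / (1 + a) ≤ 1 - a / 2 := by
        rw [div_le_iff₀ (by linarith)]; nlinarith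
      linarith
    have h3 : 3 * t ^ 2 / (12 * M ^ 2 + 4 * M * t) ≤ a / 2 := by
      rw [ha, div_div, div_le_div_iff₀ (by positivity) (by positivity)]
      have : 0 ≤ t ^ 2 * (M * t) := by positivity
      nlinarith
    have h4 : Real.exp (-(n * p * (1 - Real.exp (-a)))) ≤
        Real.exp (-(3 * n * p * t ^ 2) / (12 * M ^ 2 + 4 * M * t)) := by
      apply Real.exp_le_exp.2
      have := mul_le_mul_of_nonneg_left (h3.trans h2) hnp
      have e : -(3 * n * p * t ^ 2) / (12 * M ^ 2 + 4 * M * t)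
        = -(n * p * (3 * t ^ 2 / (12 * M ^ 2 + 4 * M * t))) := by ring
      rw [e]; linarith
    linarith
  · have h2 : (1 : ℝ) / 2 ≤ 1 - Real.exp (-a) := by
      have : 1 / (1 + a) ≤ 1 / 2 := one_div_le_one_div_of_le (by norm_num) (by linarith)
      linarith
    have h4 : Real.exp (-(n * p * (1 - Real.exp (-a)))) ≤ Real.exp (-(3 * n * p) / 28) := by
      apply Real.exp_le_exp.2
      have := mul_le_mul_of_nonneg_left h2 hnp
      linarith
    linarith

/-- One-step exponential-moment bound. -/
lemma aux_step {E : Type*} [NormedAddCommGroup E] [InnerProductSpace ℝ E] [CompleteSpace E]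
    [MeasurableSpace E]
    (ρ : Measure E) [IsProbabilityMeasure ρ] (C : Set E) (hC : MeasurableSet C)
    (f : E → E) (hfi : Integrable f ρ) (hf0 : ∫ x, f x ∂ρ = 0)
    (hfC : ∀ x, x ∉ C → f x = 0) (l M t : ℝ) (hM : 0 < M)
    (hb : ∀ᵐ x ∂ρ, ‖f x‖ ≤ M) (s : E) :
    ∫⁻ x, ENNReal.ofReal (Real.cosh (l * ‖s + f x‖)) *
        ENNReal.ofReal (Real.exp (-(l * t) * C.indicator 1 x)) ∂ρ
      ≤ ENNReal.ofReal (Real.cosh (l * ‖s‖)) *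
        ENNReal.ofReal (1 - ρ.real C + ρ.real C * (Real.exp (-(l * t)) * Real.cosh (l * M))) := by
  obtain ⟨k, hk⟩ := aux_cosh_norm s l M hM
  set R : E → ℝ := fun x => Real.cosh (l * ‖s‖) * (1 + C.indicator 1 x *
    (Real.exp (-(l * t)) * Real.cosh (l * M) - 1)) + Real.exp (-(l * t)) * k * inner ℝ s (f x)
    with hR
  have hle : ∀ᵐ x ∂ρ, Real.cosh (l * ‖s + f x‖) * Real.exp (-(l * t) * C.indicator 1 x) ≤ R x := by
    filter_upwards [hb] with x hx
    by_cases hxC : x ∈ C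
    · simp only [hR, Set.indicator_of_mem hxC, Pi.one_apply, mul_one]
      have := mul_le_mul_of_nonneg_right (hk _ hx) (Real.exp_pos (-(l * t))).le
      linarith
    · simp [hR, Set.indicator_of_notMem hxC, hfC x hxC]
  have hind : Integrable (C.indicator (1 : E → ℝ)) ρ := (integrable_const (1 : ℝ)).indicator hC
  have hin : Integrable (fun x => inner ℝ s (f x)) ρ := hfi.const_inner s
  have hRi1 : Integrable (fun x => Real.cosh (l * ‖s‖) * (1 + C.indicator (1 : E → ℝ) x *
    (Real.exp (-(l * t)) * Real.cosh (l * M) - 1))) ρ :=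
    ((integrable_const (1 : ℝ)).add (hind.mul_const _)).const_mul _
  have hRi2 : Integrable (fun x => Real.exp (-(l * t)) * k * inner ℝ s (f x)) ρ := hin.const_mul _
  have hRi : Integrable R ρ := hRi1.add hRi2
  have hint : ∫ x, R x ∂ρ = Real.cosh (l * ‖s‖) *
      (1 - ρ.real C + ρ.real C * (Real.exp (-(l * t)) * Real.cosh (l * M))) := by
    rw [hR, integral_add hRi1 hRi2, integral_const_mul, integral_const_mul,
      integral_add (integrable_const _) (hind.mul_const _), integral_mul_const,
      integral_indicator_one hC, integral_inner hfi, hf0]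
    simp
    left; ring
  have hnn : 0 ≤ᵐ[ρ] R := by
    filter_upwards [hle] with x hx
    exact le_trans (mul_nonneg (Real.cosh_pos _).le (Real.exp_pos _).le) hx
  rw [← ENNReal.ofReal_mul (Real.cosh_pos _).le, ← hint,
    ofReal_integral_eq_lintegral_ofReal hRi hnn]
  refine lintegral_mono_ae ?_
  filter_upwards [hle] with x hx
  rw [← ENNReal.ofReal_mul (Real.cosh_pos _).le]
  exact ENNReal.ofReal_le_ofReal hx

/-- The count as a sum of indicators. -/
lemma aux_count {D n : ℕ} (C : Set (EuclideanSpace ℝ (Fin D)))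
    (X : Fin n → EuclideanSpace ℝ (Fin D)) :
    (sampleCount C X : ℝ) = ∑ i, C.indicator (1 : EuclideanSpace ℝ (Fin D) → ℝ) (X i) := by
  classical
  simp [sampleCount, Nat.card_eq_fintype_card, Fintype.card_subtype, Set.indicator_apply]

/-- Bernstein inequality for the empirical conditional mean on a cell.
If ρ-a.e. point of C lies within distance θ₂·r of the conditional mean c of ρ on C, then,
except on an event of small probability, the cell C contains at least one of the n i.i.d.
samples and the empirical conditional mean ĉ is close to c. -/
theorem empirical_conditional_mean_bernstein
    (D n : ℕ) (hD : 1 ≤ D) (hn : 1 ≤ n) (r θ₂ : ℝ) (hr : 0 < r) (hθ₂ : 0 < θ₂)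
    (ρ : Measure (EuclideanSpace ℝ (Fin D))) [IsProbabilityMeasure ρ]
    (C : Set (EuclideanSpace ℝ (Fin D))) (hC : MeasurableSet C) (hρC : 0 < ρ C)
    (hbound : ∀ᵐ x ∂ρ, x ∈ C → ‖x - condMean D ρ C‖ ≤ θ₂ * r)
    (t : ℝ) (ht : 0 < t) :
    (Measure.pi fun _ : Fin n => ρ)
      {X : Fin n → EuclideanSpace ℝ (Fin D) |
        sampleCount C X = 0 ∨
          (1 ≤ sampleCount C X ∧ t ≤ ‖condEmpMean D n C X - condMean D ρ C‖)}
      ≤ ENNReal.ofReal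
          (2 * Real.exp (-(3 * n * (ρ C).toReal) / 28) +
            8 * Real.exp (-(3 * n * (ρ C).toReal * t ^ 2) /
              (12 * θ₂ ^ 2 * r ^ 2 + 4 * θ₂ * r * t))) := by
  set c := condMean D ρ C with hc
  set M := θ₂ * r with hMdef
  have hM : 0 < M := mul_pos hθ₂ hr
  set p := (ρ C).toReal with hp
  have hp0 : 0 < p := ENNReal.toReal_pos hρC.ne' (measure_ne_top _ _)
  have hp1 : p ≤ 1 := by
    have : ρ.real C ≤ 1 := measureReal_le_one
    exact this
  set f : EuclideanSpace ℝ (Fin D) → EuclideanSpace ℝ (Fin D) :=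
    C.indicator (fun x => x - c) with hf
  have hfm : Measurable f := (measurable_id.sub_const c).indicator hC
  have hb : ∀ᵐ x ∂ρ, ‖f x‖ ≤ M := by
    filter_upwards [hbound] with x hx
    by_cases hxC : x ∈ C
    · simpa [hf, Set.indicator_of_mem hxC] using hx hxC
    · simpa [hf, Set.indicator_of_notMem hxC] using hM.le
  have hfi : Integrable f ρ := Integrable.of_bound hfm.aestronglyMeasurable M hb
  have hIon : IntegrableOn (fun x => x - c) C ρ := (integrable_indicator_iff hC).1 hfi
  have hIon2 : IntegrableOn (fun x : EuclideanSpace ℝ (Fin D) => x) C ρ := by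
    have := hIon.add (integrableOn_const (μ := ρ) (s := C) (C := c) (measure_ne_top _ _))
    refine this.congr (Filter.Eventually.of_forall fun x => ?_)
    simp
  have hf0 : ∫ x, f x ∂ρ = 0 := by
    rw [hf, integral_indicator hC, integral_sub hIon2
      (integrableOn_const (measure_ne_top _ _)), setIntegral_const, hc, condMean, smul_smul]
    change _ - (p * p⁻¹) • _ = _
    rw [mul_inv_cancel₀ hp0.ne', one_smul, sub_self]
  set l := t / M ^ 2 with hl
  have hl0 : 0 < l := by positivity
  set g : EuclideanSpace ℝ (Fin D) → ENNReal :=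
    fun s => ENNReal.ofReal (Real.cosh (l * ‖s‖)) with hg
  have hgm : Measurable g := by
    have : Measurable Real.cosh := Real.continuous_cosh.measurable
    fun_prop
  set w : EuclideanSpace ℝ (Fin D) → ENNReal :=
    fun x => ENNReal.ofReal (Real.exp (-(l * t) * C.indicator 1 x)) with hw
  have hwm : Measurable w := by
    have : Measurable (C.indicator (1 : EuclideanSpace ℝ (Fin D) → ℝ)) :=
      measurable_one.indicator hC
    fun_prop
  set Q := 1 - p + p * (Real.exp (-(l * t)) * Real.cosh (l * M)) with hQ
  have hten := aux_tensor ρ g hgm f hfm w hwm (ENNReal.ofReal Q)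
    (fun s => aux_step ρ C hC f hfi hf0 (fun x hx => by simp [hf, hx]) l M t hM hb s) n 0
  have hg0 : g 0 = 1 := by simp [hg]
  rw [hg0, one_mul] at hten
  have hQ0 : 0 ≤ Q := by
    have := mul_nonneg hp0.le (mul_pos (Real.exp_pos (-(l * t))) (Real.cosh_pos (l * M))).le
    linarith
  have hQle : Q ≤ 1 - p + p * Real.exp (-(t ^ 2 / (2 * M ^ 2))) := by
    have h1 : Real.exp (-(l * t)) * Real.cosh (l * M) ≤ Real.exp (-(t ^ 2 / (2 * M ^ 2))) := by
      calc _ ≤ Real.exp (-(l * t)) * Real.exp ((l * M) ^ 2 / 2) := by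
            gcongr; exact Real.cosh_le_exp_half_sq _
        _ = _ := by
            rw [← Real.exp_add]; congr 1; rw [hl]; field_simp; ring
    have := mul_le_mul_of_nonneg_left h1 hp0.le
    linarith
  have hFm : Measurable fun X : Fin n → EuclideanSpace ℝ (Fin D) =>
      2 * (g (0 + ∑ i, f (X i)) * ∏ i, w (X i)) := by fun_prop
  have hprod : ∀ X : Fin n → EuclideanSpace ℝ (Fin D), ∏ i, w (X i) =
      ENNReal.ofReal (Real.exp (-(l * t) * sampleCount C X)) := by
    intro X
    rw [hw, ← ENNReal.ofReal_prod_of_nonneg (fun i _ => (Real.exp_pos _).le), ← Real.exp_sum,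
      ← Finset.mul_sum, aux_count]
  have hsum : ∀ X : Fin n → EuclideanSpace ℝ (Fin D), ∑ i, f (X i) =
      (∑ i, C.indicator id (X i)) - (sampleCount C X : ℝ) • c := by
    intro X
    rw [aux_count, Finset.sum_smul, ← Finset.sum_sub_distrib]
    refine Finset.sum_congr rfl fun i _ => ?_
    by_cases hx : X i ∈ C <;> simp [hf, hx]
  have htwo : ∀ x : ℝ, 2 * ENNReal.ofReal x = ENNReal.ofReal (2 * x) := by
    intro x
    rw [ENNReal.ofReal_mul (by norm_num), ENNReal.ofReal_ofNat]
  have hsub : {X : Fin n → EuclideanSpace ℝ (Fin D) | sampleCount C X = 0 ∨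
          (1 ≤ sampleCount C X ∧ t ≤ ‖condEmpMean D n C X - c‖)} ⊆
      {X | 1 ≤ 2 * (g (0 + ∑ i, f (X i)) * ∏ i, w (X i))} := by
    intro X hX
    have hge : t * sampleCount C X ≤ ‖∑ i, f (X i)‖ := by
      rcases hX with h0 | ⟨h1, h2⟩
      · simp [h0]
      · have hpos : (0 : ℝ) < sampleCount C X := by exact_mod_cast h1
        have e : ∑ i, f (X i) = (sampleCount C X : ℝ) • (condEmpMean D n C X - c) := by
          rw [hsum, condEmpMean, smul_sub, smul_smul, mul_inv_cancel₀ hpos.ne', one_smul]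
        rw [e, norm_smul, Real.norm_of_nonneg hpos.le]
        nlinarith
    show 1 ≤ 2 * (g (0 + ∑ i, f (X i)) * ∏ i, w (X i))
    rw [hprod, zero_add, hg]
    dsimp only
    rw [← ENNReal.ofReal_mul (Real.cosh_pos _).le, htwo, ← ENNReal.ofReal_one]
    apply ENNReal.ofReal_le_ofReal
    have h1 : Real.exp (l * ‖∑ i, f (X i)‖) ≤ 2 * Real.cosh (l * ‖∑ i, f (X i)‖) := by
      rw [Real.cosh_eq]
      linarith [Real.exp_pos (-(l * ‖∑ i, f (X i)‖))]
    have h2 : 1 ≤ Real.exp (l * ‖∑ i, f (X i)‖) * Real.exp (-(l * t) * sampleCount C X) := by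
      rw [← Real.exp_add]
      apply Real.one_le_exp
      nlinarith [mul_le_mul_of_nonneg_left hge hl0.le]
    calc (1 : ℝ) ≤ _ := h2
      _ ≤ _ := mul_le_mul_of_nonneg_right h1 (Real.exp_pos _).le
      _ = _ := by ring
  have hmarkov := mul_meas_ge_le_lintegral₀
    (μ := Measure.pi fun _ : Fin n => ρ) hFm.aemeasurable 1
  rw [one_mul] at hmarkov
  refine (measure_mono hsub).trans (hmarkov.trans ?_)
  rw [lintegral_const_mul _ (by fun_prop)]
  calc _ ≤ 2 * (ENNReal.ofReal Q) ^ n := by gcongr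
    _ = ENNReal.ofReal (2 * Q ^ n) := by
      rw [ENNReal.ofReal_mul (by norm_num), ENNReal.ofReal_pow hQ0, ENNReal.ofReal_ofNat]
    _ ≤ _ := by
      apply ENNReal.ofReal_le_ofReal
      have h1 := aux_numeric n p M t hp0.le hp1 hM ht
      have h2 : Q ^ n ≤ (1 - p + p * Real.exp (-(t ^ 2 / (2 * M ^ 2)))) ^ n :=
        pow_le_pow_left₀ hQ0 hQle n
      have e : 12 * θ₂ ^ 2 * r ^ 2 + 4 * θ₂ * r * t = 12 * M ^ 2 + 4 * M * t := by
        rw [hMdef]; ring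
      rw [e]
      linarith
end

section
/- Let D ≥ 1 and d ≥ 1 be integers, let ν > 0, and let n ≥ 2 satisfy 14(ν+1)·log n > 3d. Let ρ be a Borel probability measure on ℝ^D, let A ⊆ ℝ^D be a Borel set with ρ(A) ≥ 28(ν+1)·(log n)/(3n), and let X₁,…,Xₙ be i.i.d. samples with law ρ. Then the probability that fewer than d of the samples X₁,…,Xₙ lie in A is at most 2·n^{−(ν+1)}. -/
open MeasureTheory

/-- heavy cells contain at least d samples with high probability.
If ρ(A) ≥ 28(ν+1)·(log n)/(3n) and 14(ν+1)·log n > 3d, then with probability at least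
1 − 2n^{−(ν+1)} at least d of the n i.i.d. samples lie in A. -/
theorem heavy_cell_contains_d_points
    (D d n : ℕ) (hD : 1 ≤ D) (hd : 1 ≤ d) (hn : 2 ≤ n) (ν : ℝ) (hν : 0 < ν)
    (hnd : 3 * (d : ℝ) < 14 * (ν + 1) * Real.log n)
    (ρ : Measure (EuclideanSpace ℝ (Fin D))) [IsProbabilityMeasure ρ]
    (A : Set (EuclideanSpace ℝ (Fin D))) (hA : MeasurableSet A)
    (hρA : 28 * (ν + 1) * Real.log n / (3 * n) ≤ (ρ A).toReal) :
    (Measure.pi fun _ : Fin n => ρ)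
      {X : Fin n → EuclideanSpace ℝ (Fin D) | Nat.card {i : Fin n // X i ∈ A} < d}
      ≤ ENNReal.ofReal (2 * (n : ℝ) ^ (-(ν + 1))) := by
  classical
  set p : ℝ := (ρ A).toReal with hp
  set L : ℝ := (ν + 1) * Real.log n with hL
  have hn0 : (0 : ℝ) < n := by positivity
  have hL0 : 0 ≤ L := by
    have : 0 ≤ Real.log n := Real.log_natCast_nonneg n
    positivity
  have hp1 : p ≤ 1 := by
    have h : ρ.real A ≤ 1 := measureReal_le_one
    exact h
  let g : EuclideanSpace ℝ (Fin D) → ℝ := fun x => 1 - A.indicator (fun _ => (1 / 2 : ℝ)) x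
  have hi : Integrable (A.indicator (fun _ => (1 / 2 : ℝ))) ρ :=
    (integrable_const _).indicator hA
  have hg : Integrable g ρ := (integrable_const _).sub hi
  have hgi : ∫ x, g x ∂ρ = 1 - p / 2 := by
    have h1 : ∫ x, g x ∂ρ = ∫ _, (1 : ℝ) ∂ρ - ∫ x, A.indicator (fun _ => (1 / 2 : ℝ)) x ∂ρ :=
      integral_sub (integrable_const _) hi
    rw [h1, integral_indicator_const _ hA]
    simp [Measure.real, hp]
    ring
  have hgA : ∀ x, g x = if x ∈ A then 1 / 2 else 1 := by
    intro x
    by_cases hx : x ∈ A <;> simp [g, hx]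
    norm_num
  have hF : Integrable (fun X : Fin n → EuclideanSpace ℝ (Fin D) => ∏ i, g (X i))
      (Measure.pi fun _ : Fin n => ρ) := Integrable.fintype_prod (fun _ => hg)
  have hFi : ∫ X : Fin n → EuclideanSpace ℝ (Fin D), ∏ i, g (X i) ∂(Measure.pi fun _ : Fin n => ρ)
      = (1 - p / 2) ^ n := by
    rw [integral_fintype_prod_eq_prod (fun _ => g)]
    simp [hgi]
  have hFv : ∀ X : Fin n → EuclideanSpace ℝ (Fin D),
      ∏ i, g (X i) = (1 / 2 : ℝ) ^ (Nat.card {i : Fin n // X i ∈ A}) := by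
    intro X
    simp only [hgA]
    rw [Finset.prod_ite]
    simp [Fintype.card_subtype]
  have hM := mul_meas_ge_le_integral_of_nonneg (μ := Measure.pi fun _ : Fin n => ρ)
    (Filter.Eventually.of_forall fun X => by
      show (0 : ℝ) ≤ ∏ i, g (X i)
      rw [hFv]; positivity) hF ((1 / 2 : ℝ) ^ d)
  rw [hFi] at hM
  have hsub : {X : Fin n → EuclideanSpace ℝ (Fin D) | Nat.card {i : Fin n // X i ∈ A} < d} ⊆
      {X | (1 / 2 : ℝ) ^ d ≤ ∏ i, g (X i)} := by
    intro X hX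
    simp only [Set.mem_setOf_eq] at hX ⊢
    rw [hFv]
    exact pow_le_pow_of_le_one (by norm_num) (by norm_num) hX.le
  refine (measure_mono hsub).trans ?_
  rw [← ENNReal.ofReal_toReal (measure_ne_top (Measure.pi fun _ : Fin n => ρ) _)]
  apply ENNReal.ofReal_le_ofReal
  change (Measure.pi fun _ : Fin n => ρ).real _ ≤ _
  set m := (Measure.pi fun _ : Fin n => ρ).real {X | (1 / 2 : ℝ) ^ d ≤ ∏ i, g (X i)} with hm
  have h2 : ((1 / 2 : ℝ)) ^ d = Real.exp (-(d * Real.log 2)) := by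
    rw [Real.exp_neg, mul_comm, Real.exp_mul, Real.exp_log (by norm_num)]
    simp
  have h3 : (1 - p / 2) ^ n ≤ Real.exp (-(n * p / 2)) := by
    have h := Real.add_one_le_exp (-(p / 2))
    calc (1 - p / 2) ^ n ≤ (Real.exp (-(p / 2))) ^ n :=
          pow_le_pow_left₀ (by linarith) (by linarith) n
      _ = Real.exp (-(n * p / 2)) := by
          rw [← Real.exp_nat_mul]; ring_nf
  have h4 : (n : ℝ) ^ (-(ν + 1)) = Real.exp (-L) := by
    rw [Real.rpow_def_of_pos hn0, hL]; ring_nf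
  have hnp : 28 * L / 3 ≤ n * p := by
    rw [div_le_iff₀ (by positivity)] at hρA
    linarith
  have h5 : d * Real.log 2 ≤ 14 * L / 3 * 0.7 := by
    have := Real.log_two_lt_d9
    have h0 : 0 < Real.log 2 := Real.log_pos (by norm_num)
    apply mul_le_mul <;> linarith
  have h6 : m ≤ Real.exp (-L) := by
    rw [h2] at hM
    have h7 : Real.exp (-(d * Real.log 2)) * m ≤ Real.exp (-(d * Real.log 2)) * Real.exp (-L) := by
      refine hM.trans (h3.trans ?_)
      rw [← Real.exp_add]
      apply Real.exp_le_exp.2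
      linarith
    exact le_of_mul_le_mul_left h7 (Real.exp_pos _)
  rw [h4]
  linarith [Real.exp_pos (-L)]
end
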